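/- arXiv:gr-qc/0605151 — 3 statements merged into one kernel-verified Lean document; each statement's English description precedes it below -/
import Mathlib

section
/- There exist positive constants B₀, B₁, B₂ and δ > 0, depending only on L₀, C₁, C₂, C₃ and q, such that every reduced static shell with inner radius R₀ ≤ δ satisfies: (i) γ(r) > 0 for all r ∈ (R₀, R₀ + B₀·R₀^((q+3)/(q+1))]; and (ii) there exists a radius R₁ with R₀ + B₀·R₀^((q+3)/(q+1)) ≤ R₁ ≤ (R₀ + B₂·R₀^((q+2)/(q+1)))/(1 − B₁·R₀^(2/(q+1))) such that γ(r) > 0 for all r ∈ (R₀, R₁) and γ(R₁) = 0. In particular, the matter quantities ρ, p, z vanish at R₁ and the support of the shell is contained in [R₀, R₁] with R₁/R₀ → 1 as R₀ → 0. -/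
open Real MeasureTheory

noncomputable section

/-- `γ(r) = -μ(r) - (1/2)·log(1 + L₀/r²)`. -/
def gam (L₀ : ℝ) (μ : ℝ → ℝ) (r : ℝ) : ℝ :=
  -μ r - (1 / 2) * Real.log (1 + L₀ / r ^ 2)

/-- Energy density `ρ(r) = C₁·max(γ(r),0)^q / r⁴`. -/
def rho (L₀ C₁ q : ℝ) (μ : ℝ → ℝ) (r : ℝ) : ℝ :=
  C₁ * (max (gam L₀ μ r) 0) ^ q / r ^ 4

/-- Radial pressure `p(r) = C₂·max(γ(r),0)^(q+1) / r⁴`. -/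
def pres (L₀ C₂ q : ℝ) (μ : ℝ → ℝ) (r : ℝ) : ℝ :=
  C₂ * (max (gam L₀ μ r) 0) ^ (q + 1) / r ^ 4

/-- `z(r) = C₃·max(γ(r),0)^q / r²`. -/
def zfun (L₀ C₃ q : ℝ) (μ : ℝ → ℝ) (r : ℝ) : ℝ :=
  C₃ * (max (gam L₀ μ r) 0) ^ q / r ^ 2

/-- Quasi-local mass `m(r) = ∫_{R₀}^r 4π η² ρ(η) dη`. -/
def mass (R₀ L₀ C₁ q : ℝ) (μ : ℝ → ℝ) (r : ℝ) : ℝ :=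
  ∫ η in R₀..r, 4 * π * η ^ 2 * rho L₀ C₁ q μ η

/-- `μ'(r) = (m/r² + 4πrp)·e^{2λ}` with `e^{-2λ} = 1 - 2m/r`. -/
def muder (R₀ L₀ C₁ C₂ q : ℝ) (μ : ℝ → ℝ) (r : ℝ) : ℝ :=
  (mass R₀ L₀ C₁ q μ r / r ^ 2 + 4 * π * r * pres L₀ C₂ q μ r) *
    (1 - 2 * mass R₀ L₀ C₁ q μ r / r)⁻¹

/-- `γ'(r) = -μ'(r) + L₀/(r(r²+L₀))`. -/
def gamder (R₀ L₀ C₁ C₂ q : ℝ) (μ : ℝ → ℝ) (r : ℝ) : ℝ :=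
  -muder R₀ L₀ C₁ C₂ q μ r + L₀ / (r * (r ^ 2 + L₀))

/-- A reduced static shell: `γ(R₀)=0`, `2m(r)/r<1` for `r ≥ R₀`, and the
field equation `μ'(r) = (m/r² + 4πrp)·(1-2m/r)⁻¹` for `r ≥ R₀`. -/
structure IsReducedShell (R₀ L₀ C₁ C₂ q : ℝ) (μ : ℝ → ℝ) : Prop where
  inner_zero : gam L₀ μ R₀ = 0
  mass_lt : ∀ r, R₀ ≤ r → 2 * mass R₀ L₀ C₁ q μ r / r < 1
  field_eq : ∀ r, R₀ ≤ r → HasDerivAt μ (muder R₀ L₀ C₁ C₂ q μ r) r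


lemma pure_ineq {A κ c ε x : ℝ} (hA : 0 < A) (hκ : 0 < κ) (hc : 0 < c) (hcκ : c ≤ κ)
    (hAc : 4 * A * c ≤ 1) (hε : ε = c / (108 * κ)) (hx0 : 0 ≤ x) (hx1 : x ≤ 1 / 3 + ε) :
    0 ≤ κ * ((1 - 3 * x) / (1 - 2 * x) - 2 * ε) - c * (1 / 3 + ε - 2 * x)
      - 10 * A * κ * (c * x * (1 / 3 + ε - x)) := by
  have hεκ : ε * κ = c / 108 := by rw [hε]; field_simp
  have hε0 : 0 < ε := by rw [hε]; positivity
  have hε1 : ε ≤ 1 / 108 := by nlinarith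
  have hphi : 1 - 3 * x - 15 * ε ≤ (1 - 3 * x) / (1 - 2 * x) := by
    rw [le_div_iff₀ (by linarith)]
    rcases le_total x (1 / 3) with h | h
    · nlinarith
    · nlinarith
  have h1 : κ * (1 - 3 * x - 15 * ε) ≤ κ * ((1 - 3 * x) / (1 - 2 * x)) :=
    mul_le_mul_of_nonneg_left hphi hκ.le
  have hy : 0 ≤ 1 / 3 + ε - x := by linarith
  have h2 : 10 * A * κ * (c * x * (1 / 3 + ε - x)) ≤ κ * (1 / 3 + ε - x) := by
    have : 10 * A * c * x ≤ 1 := by nlinarith [mul_pos hA hc]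
    have := mul_le_mul_of_nonneg_right this (mul_nonneg hκ.le hy)
    nlinarith
  nlinarith [mul_nonneg (sub_nonneg.2 hcκ) hy]

lemma core_ineq {A κ c ε N Γ X t : ℝ} (hA0 : 0 < A) (hκ0 : 0 < κ) (hc : 0 < c) (hcκ : c ≤ κ)
    (hAc : 4 * A * c ≤ 1) (hε : ε = c / (108 * κ)) (hN0 : 0 ≤ N) (hNn : N ≤ 1 / 3 + ε)
    (hΓ0 : 0 < Γ) (hX : 1 - ε / 4 - (N + A * Γ) / (1 - 2 * N) ≤ X) (ht1 : 1 ≤ t)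
    (ht2 : t ≤ 1 + ε / 2) :
    0 ≤ κ * (t * X) - c * (1 / 3 + ε - 2 * N) + 10 * A * κ * (Γ - c * N * (1 / 3 + ε - N)) := by
  have hεκ : ε * κ = c / 108 := by rw [hε]; field_simp
  have hε0 : 0 < ε := by rw [hε]; positivity
  have hε1 : ε ≤ 1 / 108 := by nlinarith
  have hpure := pure_ineq hA0 hκ0 hc hcκ hAc hε hN0 hNn
  set φ := (1 - 3 * N) / (1 - 2 * N) with hφ
  have hden : 0 < 1 - 2 * N := by linarith
  have hsplit : 1 - (N + A * Γ) / (1 - 2 * N) = φ - A * Γ / (1 - 2 * N) := by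
    rw [hφ, ← sub_div, eq_div_iff hden.ne', sub_mul, div_mul_cancel₀ _ hden.ne']
    ring
  have hAG : 0 < A * Γ := by positivity
  have hAΓ : A * Γ / (1 - 2 * N) ≤ 5 * (A * Γ) := by
    rw [div_le_iff₀ hden]
    nlinarith
  have hφ1 : -1 / 2 ≤ φ := by
    rw [hφ, le_div_iff₀ hden]; nlinarith
  have hX2 : φ - ε / 4 - 5 * (A * Γ) ≤ X := by linarith
  have hX3 : -(1 + 5 * (A * Γ)) ≤ X := by linarith
  have hu : φ - 2 * ε - 10 * (A * Γ) ≤ t * X := by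
    have h1 := mul_le_mul_of_nonneg_left hX3 (sub_nonneg.2 ht1)
    have h2 : (t - 1) * (1 + 5 * (A * Γ)) ≤ ε / 2 * (1 + 5 * (A * Γ)) :=
      mul_le_mul_of_nonneg_right (by linarith) (by linarith)
    have h3 : ε * (A * Γ) ≤ 1 / 108 * (A * Γ) := mul_le_mul_of_nonneg_right hε1 hAG.le
    linarith
  have h4 := mul_le_mul_of_nonneg_left hu hκ0.le
  linarith

lemma gam_hasDerivAt {R₀ L₀ C₁ C₂ q : ℝ} {μ : ℝ → ℝ} (hL₀ : 0 < L₀) (hR : 0 < R₀)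
    (h : IsReducedShell R₀ L₀ C₁ C₂ q μ) {r : ℝ} (hr : R₀ ≤ r) :
    HasDerivAt (gam L₀ μ) (gamder R₀ L₀ C₁ C₂ q μ r) r := by
  have hr0 : 0 < r := by linarith
  have h1 := h.field_eq r hr
  have h2 : HasDerivAt (fun r : ℝ => 1 + L₀ / r ^ 2) (L₀ * (-(2 * r) / (r ^ 2) ^ 2)) r := by
    have := (((hasDerivAt_pow 2 r).inv (by positivity)).const_mul L₀).const_add 1
    simpa [div_eq_mul_inv] using this
  have h3 := (h2.log (by positivity)).const_mul (1 / 2 : ℝ)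
  have h4 := h1.neg.sub h3
  have h5 : HasDerivAt (gam L₀ μ) _ r := h4
  refine h5.congr_deriv ?_
  unfold gamder
  have : r ^ 2 + L₀ ≠ 0 := by positivity
  have e : 1 + L₀ / r ^ 2 = (r ^ 2 + L₀) / r ^ 2 := by field_simp
  rw [e]
  field_simp
  ring

lemma gam_cont {R₀ L₀ C₁ C₂ q : ℝ} {μ : ℝ → ℝ} (hL₀ : 0 < L₀) (hR : 0 < R₀)
    (h : IsReducedShell R₀ L₀ C₁ C₂ q μ) : ContinuousOn (gam L₀ μ) (Set.Ici R₀) :=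
  fun _ hr => (gam_hasDerivAt hL₀ hR h hr).continuousAt.continuousWithinAt

lemma integrand_cont {R₀ L₀ C₁ C₂ q : ℝ} {μ : ℝ → ℝ} (hL₀ : 0 < L₀) (hR : 0 < R₀) (hq : 2 ≤ q)
    (h : IsReducedShell R₀ L₀ C₁ C₂ q μ) :
    ContinuousOn (fun η => 4 * π * η ^ 2 * rho L₀ C₁ q μ η) (Set.Ici R₀) := by
  unfold rho
  have h1 := gam_cont hL₀ hR h
  have h2 : ContinuousOn (fun η => (max (gam L₀ μ η) 0) ^ q) (Set.Ici R₀) :=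
    (h1.sup continuousOn_const).rpow_const (fun _ _ => Or.inr (by linarith))
  refine (by fun_prop : ContinuousOn (fun η : ℝ => 4 * π * η ^ 2) (Set.Ici R₀)).mul ?_
  refine (continuousOn_const.mul h2).div (by fun_prop) ?_
  intro x hx
  have : 0 < x := lt_of_lt_of_le hR hx
  positivity

lemma mass_hasDerivAt {R₀ L₀ C₁ C₂ q : ℝ} {μ : ℝ → ℝ} (hL₀ : 0 < L₀) (hR : 0 < R₀) (hq : 2 ≤ q)
    (h : IsReducedShell R₀ L₀ C₁ C₂ q μ) {r : ℝ} (hr : R₀ < r) :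
    HasDerivAt (mass R₀ L₀ C₁ q μ) (4 * π * C₁ * (max (gam L₀ μ r) 0) ^ q / r ^ 2) r := by
  have hc := integrand_cont hL₀ hR hq h
  have hr0 : 0 < r := by linarith
  have h1 : HasDerivAt (mass R₀ L₀ C₁ q μ) (4 * π * r ^ 2 * rho L₀ C₁ q μ r) r := by
    unfold mass
    refine intervalIntegral.integral_hasDerivAt_right ?_ ?_ ?_
    · exact (hc.mono (by rw [Set.uIcc_of_le hr.le]; exact Set.Icc_subset_Ici_self)).intervalIntegrable
    · exact (hc.mono Set.Ioi_subset_Ici_self).stronglyMeasurableAtFilter isOpen_Ioi r hr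
    · exact hc.continuousAt (Ici_mem_nhds hr)
  convert h1 using 1
  unfold rho
  field_simp

lemma mass_cont {R₀ L₀ C₁ C₂ q : ℝ} {μ : ℝ → ℝ} (hL₀ : 0 < L₀) (hR : 0 < R₀) (hq : 2 ≤ q)
    (h : IsReducedShell R₀ L₀ C₁ C₂ q μ) (b : ℝ) (hb : R₀ ≤ b) :
    ContinuousOn (mass R₀ L₀ C₁ q μ) (Set.Icc R₀ b) := by
  have hc := integrand_cont hL₀ hR hq h
  unfold mass
  have := intervalIntegral.continuousOn_primitive_interval (a := R₀) (b := b) (μ := volume)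
    (f := fun η => 4 * π * η ^ 2 * rho L₀ C₁ q μ η)
    ((hc.mono (by rw [Set.uIcc_of_le hb]; exact Set.Icc_subset_Ici_self)).integrableOn_compact
      isCompact_uIcc)
  rwa [Set.uIcc_of_le hb] at this

lemma mass_mono {R₀ L₀ C₁ C₂ q : ℝ} {μ : ℝ → ℝ} (hL₀ : 0 < L₀) (hR : 0 < R₀) (hq : 2 ≤ q)
    (hC₁ : 0 < C₁)
    (h : IsReducedShell R₀ L₀ C₁ C₂ q μ) (b : ℝ) (hb : R₀ ≤ b) :
    MonotoneOn (mass R₀ L₀ C₁ q μ) (Set.Icc R₀ b) := by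
  refine monotoneOn_of_hasDerivWithinAt_nonneg (convex_Icc _ _) (mass_cont hL₀ hR hq h b hb)
    (f' := fun r => 4 * π * C₁ * (max (gam L₀ μ r) 0) ^ q / r ^ 2) ?_ ?_
  · intro x hx
    rw [interior_Icc] at hx
    exact (mass_hasDerivAt hL₀ hR hq h hx.1).hasDerivWithinAt
  · intro x hx
    have : 0 ≤ (max (gam L₀ μ x) 0) ^ q := Real.rpow_nonneg (le_max_right _ _) _
    positivity

lemma mass_self {R₀ L₀ C₁ q : ℝ} {μ : ℝ → ℝ} : mass R₀ L₀ C₁ q μ R₀ = 0 := by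
  unfold mass; simp

lemma mass_nonneg {R₀ L₀ C₁ C₂ q : ℝ} {μ : ℝ → ℝ} (hL₀ : 0 < L₀) (hR : 0 < R₀) (hq : 2 ≤ q)
    (hC₁ : 0 < C₁)
    (h : IsReducedShell R₀ L₀ C₁ C₂ q μ) {r : ℝ} (hr : R₀ ≤ r) : 0 ≤ mass R₀ L₀ C₁ q μ r := by
  have := mass_mono hL₀ hR hq hC₁ h r hr (Set.left_mem_Icc.2 hr) (Set.right_mem_Icc.2 hr) hr
  rwa [mass_self] at this

lemma mass_pos {R₀ L₀ C₁ C₂ q : ℝ} {μ : ℝ → ℝ} (hL₀ : 0 < L₀) (hR : 0 < R₀) (hq : 2 ≤ q)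
    (hC₁ : 0 < C₁)
    (h : IsReducedShell R₀ L₀ C₁ C₂ q μ) {r : ℝ} (hr : R₀ < r)
    (hpos : ∀ s, R₀ < s → s < r → 0 < gam L₀ μ s) : 0 < mass R₀ L₀ C₁ q μ r := by
  have hc := integrand_cont hL₀ hR hq h
  unfold mass
  refine intervalIntegral.intervalIntegral_pos_of_pos_on ?_ ?_ hr
  · exact (hc.mono (by rw [Set.uIcc_of_le hr.le]; exact Set.Icc_subset_Ici_self)).intervalIntegrable
  · intro x hx
    have h1 := hpos x hx.1 hx.2
    have h0 : 0 < x := hR.trans hx.1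
    have : 0 < (max (gam L₀ μ x) 0) ^ q := Real.rpow_pos_of_pos (lt_max_of_lt_left h1) _
    unfold rho
    positivity

lemma gamder_eq {R₀ L₀ C₁ C₂ q : ℝ} {μ : ℝ → ℝ} (hL₀ : 0 < L₀) {r : ℝ} (hr : 0 < r) :
    r * gamder R₀ L₀ C₁ C₂ q μ r = L₀ / (r ^ 2 + L₀) -
      (mass R₀ L₀ C₁ q μ r / r + 4 * π * C₂ * (max (gam L₀ μ r) 0) ^ (q + 1) / r ^ 2) /
        (1 - 2 * (mass R₀ L₀ C₁ q μ r / r)) := by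
  unfold gamder muder pres
  have e : 1 - 2 * mass R₀ L₀ C₁ q μ r / r = 1 - 2 * (mass R₀ L₀ C₁ q μ r / r) := by ring
  rw [e, div_eq_mul_inv _ (1 - 2 * (mass R₀ L₀ C₁ q μ r / r))]
  generalize (1 - 2 * (mass R₀ L₀ C₁ q μ r / r))⁻¹ = v
  have : r ^ 2 + L₀ ≠ 0 := by positivity
  field_simp
  ring

/-- Upper bound for the derivative of `γ` in terms of a lower bound of the mass ratio. -/
lemma gamder_le {R₀ L₀ C₁ C₂ q : ℝ} {μ : ℝ → ℝ} (hL₀ : 0 < L₀) (hR : 0 < R₀) (hq : 2 ≤ q)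
    (hC₁ : 0 < C₁) (hC₂ : 0 < C₂)
    (h : IsReducedShell R₀ L₀ C₁ C₂ q μ) {r : ℝ} (hr : R₀ ≤ r) :
    r * gamder R₀ L₀ C₁ C₂ q μ r ≤ 1 - (mass R₀ L₀ C₁ q μ r / r) /
        (1 - 2 * (mass R₀ L₀ C₁ q μ r / r)) := by
  have hr0 : 0 < r := by linarith
  rw [gamder_eq hL₀ hr0]
  have h1 := h.mass_lt r hr
  have e : 2 * mass R₀ L₀ C₁ q μ r / r = 2 * (mass R₀ L₀ C₁ q μ r / r) := by ring
  rw [e] at h1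
  have h3 : L₀ / (r ^ 2 + L₀) ≤ 1 := by
    rw [div_le_one (by positivity)]; nlinarith
  have h4 : 0 ≤ (max (gam L₀ μ r) 0) ^ (q + 1) := Real.rpow_nonneg (le_max_right _ _) _
  have h5 : (mass R₀ L₀ C₁ q μ r / r) / (1 - 2 * (mass R₀ L₀ C₁ q μ r / r)) ≤
     (mass R₀ L₀ C₁ q μ r / r + 4 * π * C₂ * (max (gam L₀ μ r) 0) ^ (q + 1) / r ^ 2) /
        (1 - 2 * (mass R₀ L₀ C₁ q μ r / r)) := by
    apply div_le_div_of_nonneg_right _ (by linarith)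
    have : 0 ≤ 4 * π * C₂ * (max (gam L₀ μ r) 0) ^ (q + 1) / r ^ 2 := by positivity
    linarith
  linarith

lemma gam_le {R₀ L₀ C₁ C₂ q : ℝ} {μ : ℝ → ℝ} (hL₀ : 0 < L₀) (hR : 0 < R₀) (hq : 2 ≤ q)
    (hC₁ : 0 < C₁) (hC₂ : 0 < C₂)
    (h : IsReducedShell R₀ L₀ C₁ C₂ q μ) {r : ℝ} (hr : R₀ ≤ r) :
    gam L₀ μ r ≤ (r - R₀) / R₀ := by
  have hd : ∀ x ∈ Set.Icc R₀ r, HasDerivAt (fun x => gam L₀ μ x - (x - R₀) / R₀)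
      (gamder R₀ L₀ C₁ C₂ q μ x - 1 / R₀) x := fun x hx =>
    (gam_hasDerivAt hL₀ hR h hx.1).sub (((hasDerivAt_id x).sub_const R₀).div_const R₀)
  have hm : AntitoneOn (fun x => gam L₀ μ x - (x - R₀) / R₀) (Set.Icc R₀ r) := by
    refine antitoneOn_of_hasDerivWithinAt_nonpos (convex_Icc _ _)
      (fun x hx => (hd x hx).continuousAt.continuousWithinAt)
      (fun x hx => (hd x (interior_subset hx)).hasDerivWithinAt) ?_
    intro x hx
    have hx' := (interior_subset hx : x ∈ Set.Icc R₀ r).1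
    have hx0 : 0 < x := by linarith
    have h1 := gamder_le hL₀ hR hq hC₁ hC₂ h hx'
    have h2 := h.mass_lt x hx'
    have h3 := mass_nonneg hL₀ hR hq hC₁ h hx'
    have e : 2 * mass R₀ L₀ C₁ q μ x / x = 2 * (mass R₀ L₀ C₁ q μ x / x) := by ring
    rw [e] at h2
    have h4 : 0 ≤ (mass R₀ L₀ C₁ q μ x / x) / (1 - 2 * (mass R₀ L₀ C₁ q μ x / x)) :=
      div_nonneg (by positivity) (by linarith)
    have h5 : gamder R₀ L₀ C₁ C₂ q μ x ≤ 1 / x := by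
      rw [le_div_iff₀ hx0]; linarith
    have h6 : 1 / x ≤ 1 / R₀ := one_div_le_one_div_of_le hR hx'
    linarith
  have := hm (Set.left_mem_Icc.2 hr) (Set.right_mem_Icc.2 hr) hr
  simp only [h.inner_zero, sub_self, zero_div] at this
  linarith

lemma frac_mono {M N P : ℝ} (h0 : M ≤ N) (hN : 2 * N < 1) (hM : 0 ≤ M) {P' : ℝ} (hP : 0 ≤ P)
    (hP' : P ≤ P') : (M + P) / (1 - 2 * M) ≤ (N + P') / (1 - 2 * N) := by
  rw [div_le_div_iff₀ (by linarith) (by linarith)]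
  nlinarith [mul_nonneg hP (sub_nonneg.2 h0), mul_nonneg (sub_nonneg.2 hP') (by linarith : 0 ≤ 1 - 2 * M)]

/-- The barrier: as long as the shell has not ended and the mass is subcritical. -/
lemma barrier {R₀ L₀ C₁ C₂ q : ℝ} {μ : ℝ → ℝ} (hL₀ : 0 < L₀) (hR : 0 < R₀) (hq : 2 ≤ q)
    (hC₁ : 0 < C₁) (hC₂ : 0 < C₂)
    (h : IsReducedShell R₀ L₀ C₁ C₂ q μ) {A κ c ε b : ℝ} (hA : A = 4 * π * C₂)
    (hκ : κ = (q + 1) / (4 * π * C₁)) (hc : 0 < c) (hcκ : c ≤ κ)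
    (hAc : 4 * A * c ≤ 1) (hε : ε = c / (108 * κ)) (hRε : 4 * R₀ ^ 2 ≤ ε / 4 * L₀)
    (hb : R₀ ≤ b) (hb' : b ≤ (1 + ε / 2) * R₀) (hpos : ∀ s, R₀ < s → s < b → 0 < gam L₀ μ s)
    (hm : mass R₀ L₀ C₁ q μ b / R₀ ≤ 1 / 3 + ε) :
    c * (mass R₀ L₀ C₁ q μ b / R₀) * (1 / 3 + ε - mass R₀ L₀ C₁ q μ b / R₀) ≤
      (max (gam L₀ μ b) 0) ^ (q + 1) / R₀ ^ 2 := by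
  have hA0 : 0 < A := by rw [hA]; positivity
  have hκ0 : 0 < κ := by linarith
  have hε0 : 0 < ε := by rw [hε]; positivity
  have hεκ : ε * κ = c / 108 := by rw [hε]; field_simp
  have hε1 : ε ≤ 1 / 108 := by nlinarith
  set N : ℝ → ℝ := fun r => mass R₀ L₀ C₁ q μ r / R₀ with hN
  set g := gam L₀ μ with hg
  have hNc : ContinuousOn N (Set.Icc R₀ b) := (mass_cont hL₀ hR hq h b hb).div_const _
  have hgc : ContinuousOn g (Set.Icc R₀ b) := (gam_cont hL₀ hR h).mono Set.Icc_subset_Ici_self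
  have hGc : ContinuousOn (fun r => (max (g r) 0) ^ (q + 1)) (Set.Icc R₀ b) :=
    (hgc.sup continuousOn_const).rpow_const (fun _ _ => Or.inr (by linarith))
  set D : ℝ → ℝ := fun r => ((max (g r) 0) ^ (q + 1) / R₀ ^ 2 - c * N r * (1 / 3 + ε - N r)) *
    Real.exp (10 * A * κ * N r) with hD
  have hDc : ContinuousOn D (Set.Icc R₀ b) := by
    refine ContinuousOn.mul ?_ ?_
    · exact (hGc.div_const _).sub ((continuousOn_const.mul hNc).mul (continuousOn_const.sub hNc))
    · exact (continuousOn_const.mul hNc).rexp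
  have hmono : MonotoneOn D (Set.Icc R₀ b) := by
    let Nd : ℝ → ℝ := fun r => 4 * π * C₁ * (g r) ^ q / r ^ 2 / R₀
    let Gd : ℝ → ℝ := fun r => (gamder R₀ L₀ C₁ C₂ q μ r * (q + 1) * (g r) ^ q) / R₀ ^ 2
    refine monotoneOn_of_hasDerivWithinAt_nonneg (convex_Icc _ _) hDc
      (f' := fun r => (Gd r - (c * Nd r * (1 / 3 + ε - N r) + c * N r * (- Nd r))) *
        Real.exp (10 * A * κ * N r) +
        ((g r) ^ (q + 1) / R₀ ^ 2 - c * N r * (1 / 3 + ε - N r)) *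
        (Real.exp (10 * A * κ * N r) * (10 * A * κ * Nd r))) ?_ ?_
    · intro x hx
      rw [interior_Icc] at hx
      have hgx : 0 < g x := hpos x hx.1 hx.2
      have hN1 : HasDerivAt N (Nd x) x := by
        have := (mass_hasDerivAt hL₀ hR hq h hx.1).div_const R₀
        rw [max_eq_left (by exact hgx.le)] at this
        exact this
      have hg1 := gam_hasDerivAt hL₀ hR h hx.1.le
      have hG1 : HasDerivAt (fun r => (max (g r) 0) ^ (q + 1) / R₀ ^ 2) (Gd x) x := by
        have h1 := (hg1.rpow_const (p := q + 1) (Or.inl hgx.ne')).div_const (R₀ ^ 2)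
        have e : q + 1 - 1 = q := by ring
        rw [e] at h1
        refine h1.congr_of_eventuallyEq ?_
        filter_upwards [Ioo_mem_nhds hx.1 hx.2] with y hy
        rw [max_eq_left (hpos y hy.1 hy.2).le]
      have := (hG1.sub ((hN1.const_mul c).mul (hN1.const_sub (1 / 3 + ε)))).mul
        (hN1.const_mul (10 * A * κ)).exp
      refine HasDerivAt.hasDerivWithinAt ?_
      have e : (max (g x) 0) ^ (q + 1) = (g x) ^ (q + 1) := by rw [max_eq_left hgx.le]
      rw [← e]
      exact this
    · intro x hx
      rw [interior_Icc] at hx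
      have hgx : 0 < g x := hpos x hx.1 hx.2
      have hx0 : 0 < x := hR.trans hx.1
      have hNd : 0 < Nd x := by
        have : 0 < (g x) ^ q := Real.rpow_pos_of_pos hgx _
        simp only [Nd]; positivity
      have hG0 : 0 < (g x) ^ (q + 1) := Real.rpow_pos_of_pos hgx _
      have hN0 : 0 ≤ N x := div_nonneg (mass_nonneg hL₀ hR hq hC₁ h hx.1.le) hR.le
      have hNn : N x ≤ 1 / 3 + ε := by
        refine le_trans ?_ hm
        exact div_le_div_of_nonneg_right (mass_mono hL₀ hR hq hC₁ h b hb
          (Set.Ioo_subset_Icc_self hx) (Set.right_mem_Icc.2 hb) hx.2.le) hR.le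
      have hGd : Gd x = Nd x * (κ * ((x / R₀) * (x * gamder R₀ L₀ C₁ C₂ q μ x))) := by
        simp only [Gd, Nd, hκ]
        field_simp
      -- bound of the derivative
      have hX : 1 - ε / 4 - (N x + A * ((g x) ^ (q + 1) / R₀ ^ 2)) / (1 - 2 * N x) ≤
          x * gamder R₀ L₀ C₁ C₂ q μ x := by
        rw [gamder_eq hL₀ hx0, max_eq_left hgx.le]
        have h1 : 1 - ε / 4 ≤ L₀ / (x ^ 2 + L₀) := by
          rw [le_div_iff₀ (by positivity)]
          have : x ≤ 2 * R₀ := by nlinarith [hx.2]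
          have : x ^ 2 ≤ 4 * R₀ ^ 2 := by nlinarith
          nlinarith [sq_nonneg x]
        have h2 : (mass R₀ L₀ C₁ q μ x / x + 4 * π * C₂ * g x ^ (q + 1) / x ^ 2) /
            (1 - 2 * (mass R₀ L₀ C₁ q μ x / x)) ≤
            (N x + A * ((g x) ^ (q + 1) / R₀ ^ 2)) / (1 - 2 * N x) := by
          have hm0 := mass_nonneg hL₀ hR hq hC₁ h hx.1.le
          refine frac_mono ?_ (by linarith) (by positivity) (by positivity) ?_
          · exact div_le_div_of_nonneg_left hm0 hR hx.1.le
          · rw [hA, mul_div_assoc]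
            refine mul_le_mul_of_nonneg_left ?_ (by positivity)
            refine div_le_div_of_nonneg_left hG0.le (by positivity) ?_
            exact pow_le_pow_left₀ hR.le hx.1.le 2
        linarith
      set Γ := (g x) ^ (q + 1) / R₀ ^ 2 with hΓ
      have hΓ0 : 0 < Γ := by positivity
      have ht1 : 1 ≤ x / R₀ := by rw [le_div_iff₀ hR]; linarith [hx.1]
      have ht2 : x / R₀ ≤ 1 + ε / 2 := by rw [div_le_iff₀ hR]; linarith [hx.2]
      have key := core_ineq hA0 hκ0 hc hcκ hAc hε hN0 hNn hΓ0 hX ht1 ht2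
      have := mul_nonneg (mul_nonneg hNd.le key) (Real.exp_pos (10 * A * κ * N x)).le
      rw [hGd]
      refine this.trans_eq ?_
      ring
  have h0 : D R₀ = 0 := by
    have : g R₀ = 0 := h.inner_zero
    simp only [hD, hN, this, mass_self]
    rw [max_self, Real.zero_rpow (by linarith)]
    simp
  have h1 := hmono (Set.left_mem_Icc.2 hb) (Set.right_mem_Icc.2 hb) hb
  rw [h0] at h1
  have h2 := nonneg_of_mul_nonneg_left h1 (Real.exp_pos _)
  linarith

/-- The mass grows quickly while it is subcritical. -/
lemma growth {R₀ L₀ C₁ C₂ q : ℝ} {μ : ℝ → ℝ} (hL₀ : 0 < L₀) (hR : 0 < R₀) (hq : 2 ≤ q)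
    (hC₁ : 0 < C₁)
    (h : IsReducedShell R₀ L₀ C₁ C₂ q μ) {k b : ℝ} (hk : 0 < k)
    (hb : R₀ < b) (hb' : b ≤ 2 * R₀) (hpos : ∀ s, R₀ < s → s < b → 0 < gam L₀ μ s)
    (hG : ∀ s, R₀ < s → s < b → k * (mass R₀ L₀ C₁ q μ s / R₀) ≤ (gam L₀ μ s) ^ (q + 1) / R₀ ^ 2) :
    π * C₁ * k ^ (q / (q + 1)) / (q + 1) * (b - R₀) ≤
      (mass R₀ L₀ C₁ q μ b / R₀) ^ (1 / (q + 1)) * (R₀ * R₀ ^ (2 / (q + 1))) := by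
  have hq1 : 0 < q + 1 := by linarith
  set N : ℝ → ℝ := fun r => mass R₀ L₀ C₁ q μ r / R₀ with hN
  have hNc : ContinuousOn N (Set.Icc R₀ b) := (mass_cont hL₀ hR hq h b hb.le).div_const _
  set T := R₀ * R₀ ^ (2 / (q + 1)) with hT
  have hT0 : 0 < T := by positivity
  set K := π * C₁ * k ^ (q / (q + 1)) / (q + 1) with hK
  have hmono : MonotoneOn (fun r => (N r) ^ (1 / (q + 1)) * T - K * (r - R₀)) (Set.Icc R₀ b) := by
    refine monotoneOn_of_hasDerivWithinAt_nonneg (convex_Icc _ _) ?_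
      (f' := fun r => (4 * π * C₁ * (gam L₀ μ r) ^ q / r ^ 2 / R₀) * (1 / (q + 1)) *
        (N r) ^ (1 / (q + 1) - 1) * T - K * 1) ?_ ?_
    · refine ((hNc.rpow_const (fun _ _ => Or.inr (by positivity))).mul continuousOn_const).sub
        (by fun_prop)
    · intro x hx
      rw [interior_Icc] at hx
      have hgx := hpos x hx.1 hx.2
      have hN0 : 0 < N x := div_pos (mass_pos hL₀ hR hq hC₁ h hx.1
        (fun s h1 h2 => hpos s h1 (h2.trans hx.2))) hR
      have hN1 := (mass_hasDerivAt hL₀ hR hq h hx.1).div_const R₀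
      rw [max_eq_left hgx.le] at hN1
      exact (((hN1.rpow_const (p := 1 / (q + 1)) (Or.inl hN0.ne')).mul_const T).sub
        (((hasDerivAt_id x).sub_const R₀).const_mul K)).hasDerivWithinAt
    · intro x hx
      rw [interior_Icc] at hx
      have hgx := hpos x hx.1 hx.2
      have hx0 : 0 < x := hR.trans hx.1
      have hN0 : 0 < N x := div_pos (mass_pos hL₀ hR hq hC₁ h hx.1
        (fun s h1 h2 => hpos s h1 (h2.trans hx.2))) hR
      have h1 : k * N x * R₀ ^ 2 ≤ (gam L₀ μ x) ^ (q + 1) := by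
        have := hG x hx.1 hx.2
        rwa [le_div_iff₀ (by positivity)] at this
      have h2 : (k * N x * R₀ ^ 2) ^ (q / (q + 1)) ≤ (gam L₀ μ x) ^ q := by
        have := Real.rpow_le_rpow (by positivity) h1 (by positivity : 0 ≤ q / (q + 1))
        rwa [← Real.rpow_mul hgx.le, mul_div_cancel₀ _ hq1.ne'] at this
      rw [Real.mul_rpow (by positivity) (by positivity), Real.mul_rpow hk.le hN0.le] at h2
      have e1 : (N x) ^ (1 / (q + 1) - 1) * (N x) ^ (q / (q + 1)) = 1 := by
        rw [← Real.rpow_add hN0]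
        have : 1 / (q + 1) - 1 + q / (q + 1) = 0 := by field_simp; ring
        rw [this, Real.rpow_zero]
      have e2 : (R₀ ^ 2) ^ (q / (q + 1)) * T = R₀ ^ 3 := by
        rw [hT, ← Real.rpow_natCast R₀ 2, ← Real.rpow_mul hR.le]
        calc R₀ ^ (((2 : ℕ) : ℝ) * (q / (q + 1))) * (R₀ * R₀ ^ (2 / (q + 1)))
            = R₀ * (R₀ ^ (((2 : ℕ) : ℝ) * (q / (q + 1))) * R₀ ^ (2 / (q + 1))) := by ring
          _ = R₀ * R₀ ^ ((2 : ℕ) : ℝ) := by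
              rw [← Real.rpow_add hR]; congr 2; push_cast; field_simp
          _ = R₀ ^ 3 := by rw [Real.rpow_natCast]; ring
      have h3 : k ^ (q / (q + 1)) * R₀ ^ 3 ≤
          (gam L₀ μ x) ^ q * ((N x) ^ (1 / (q + 1) - 1) * T) := by
        have := mul_le_mul_of_nonneg_right h2
          (by positivity : 0 ≤ (N x) ^ (1 / (q + 1) - 1) * T)
        refine le_trans (le_of_eq ?_) this
        calc _ = k ^ (q / (q + 1)) * ((N x) ^ (1 / (q + 1) - 1) * (N x) ^ (q / (q + 1))) *
              ((R₀ ^ 2) ^ (q / (q + 1)) * T) := by rw [e1, e2]; ring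
          _ = _ := by ring
      have hx2 : x ^ 2 * R₀ ≤ 4 * R₀ ^ 3 := by
        have : x ≤ 2 * R₀ := by linarith [hx.2]
        have : x ^ 2 ≤ 4 * R₀ ^ 2 := by nlinarith
        nlinarith
      have e3 : (4 * π * C₁ * (gam L₀ μ x) ^ q / x ^ 2 / R₀) * (1 / (q + 1)) *
        (N x) ^ (1 / (q + 1) - 1) * T = (π * C₁ / (q + 1)) *
          (4 * ((gam L₀ μ x) ^ q * ((N x) ^ (1 / (q + 1) - 1) * T)) / (x ^ 2 * R₀)) := by
        field_simp
      have h4 : k ^ (q / (q + 1)) ≤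
          4 * ((gam L₀ μ x) ^ q * ((N x) ^ (1 / (q + 1) - 1) * T)) / (x ^ 2 * R₀) := by
        rw [le_div_iff₀ (by positivity)]
        have := mul_le_mul_of_nonneg_left hx2 (by positivity : 0 ≤ k ^ (q / (q + 1)))
        linarith
      have h5 := mul_le_mul_of_nonneg_left h4 (by positivity : 0 ≤ π * C₁ / (q + 1))
      have e4 : K * 1 = π * C₁ / (q + 1) * k ^ (q / (q + 1)) := by rw [hK]; ring
      rw [e3, e4]
      linarith
  have := hmono (Set.left_mem_Icc.2 hb.le) (Set.right_mem_Icc.2 hb.le) hb.le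
  have e0 : N R₀ = 0 := by simp [hN, mass_self]
  simp only [e0] at this
  rw [Real.zero_rpow (by positivity)] at this
  linarith

lemma mass_le {R₀ L₀ C₁ C₂ q : ℝ} {μ : ℝ → ℝ} (hL₀ : 0 < L₀) (hR : 0 < R₀) (hq : 2 ≤ q)
    (hC₁ : 0 < C₁)
    (h : IsReducedShell R₀ L₀ C₁ C₂ q μ) {b G : ℝ} (hb : R₀ ≤ b) (hG0 : 0 ≤ G)
    (hG : ∀ s, R₀ < s → s < b → gam L₀ μ s ≤ G) :
    mass R₀ L₀ C₁ q μ b ≤ 4 * π * C₁ * G ^ q / R₀ ^ 2 * (b - R₀) := by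
  have hm : AntitoneOn (fun r => mass R₀ L₀ C₁ q μ r - 4 * π * C₁ * G ^ q / R₀ ^ 2 * (r - R₀))
      (Set.Icc R₀ b) := by
    refine antitoneOn_of_hasDerivWithinAt_nonpos (convex_Icc _ _)
      ((mass_cont hL₀ hR hq h b hb).sub (by fun_prop))
      (f' := fun r => 4 * π * C₁ * (max (gam L₀ μ r) 0) ^ q / r ^ 2 -
        4 * π * C₁ * G ^ q / R₀ ^ 2 * 1) ?_ ?_
    · intro x hx
      rw [interior_Icc] at hx
      exact ((mass_hasDerivAt hL₀ hR hq h hx.1).sub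
        (((hasDerivAt_id x).sub_const R₀).const_mul _)).hasDerivWithinAt
    · intro x hx
      rw [interior_Icc] at hx
      have h1 : (max (gam L₀ μ x) 0) ^ q ≤ G ^ q :=
        Real.rpow_le_rpow (le_max_right _ _) (max_le (hG x hx.1 hx.2) hG0) (by linarith)
      have h2 : R₀ ^ 2 ≤ x ^ 2 := pow_le_pow_left₀ hR.le hx.1.le 2
      have h3 : 0 ≤ G ^ q := Real.rpow_nonneg hG0 _
      have : 4 * π * C₁ * (max (gam L₀ μ x) 0) ^ q / x ^ 2 ≤ 4 * π * C₁ * G ^ q / R₀ ^ 2 :=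
        div_le_div₀ (by positivity) (mul_le_mul_of_nonneg_left h1 (by positivity))
          (by positivity) h2
      linarith
  have := hm (Set.left_mem_Icc.2 hb) (Set.right_mem_Icc.2 hb) hb
  simp only [mass_self, sub_self, mul_zero] at this
  linarith

/-- The first zero of `γ` after an initial rise. -/
lemma first_zero {g : ℝ → ℝ} {R b d : ℝ} (hg : ContinuousOn g (Set.Ici R)) (h0 : g R = 0)
    (hd : HasDerivAt g d R) (hd0 : 0 < d) (hb : ∃ s, R < s ∧ s ≤ b ∧ g s ≤ 0) :
    ∃ r, R < r ∧ r ≤ b ∧ g r = 0 ∧ ∀ s, R < s → s < r → 0 < g s := by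
  have h1 : ∀ᶠ x in nhdsWithin R (Set.Ioi R), 0 < g x := by
    have := (hasDerivAt_iff_tendsto_slope.1 hd).eventually (lt_mem_nhds hd0)
    have h2 := this.filter_mono (nhdsWithin_mono R (fun x (hx : R < x) => ne_of_gt hx))
    filter_upwards [h2, self_mem_nhdsWithin] with x hx hx'
    rw [slope_def_field, h0, sub_zero] at hx
    have : 0 < x - R := sub_pos.2 hx'
    exact (div_pos_iff_of_pos_right this).1 hx
  obtain ⟨u, hu, hu'⟩ := mem_nhdsGT_iff_exists_Ioo_subset.1 h1
  have hu0 : R < u := hu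
  obtain ⟨s, hs1, hs2, hs3⟩ := hb
  have hcomp : IsCompact (Set.Icc u b ∩ g ⁻¹' Set.Iic 0) := by
    refine isCompact_Icc.of_isClosed_subset ?_ Set.inter_subset_left
    exact (hg.mono (fun x hx => hu0.le.trans hx.1)).preimage_isClosed_of_isClosed isClosed_Icc
      isClosed_Iic
  have hne : (Set.Icc u b ∩ g ⁻¹' Set.Iic 0).Nonempty := by
    refine ⟨s, ⟨?_, hs2⟩, hs3⟩
    by_contra hlt
    have : 0 < g s := hu' ⟨hs1, not_le.1 hlt⟩
    linarith
  obtain ⟨r, ⟨⟨hr1, hr2⟩, hr3⟩, hmin⟩ := hcomp.exists_isLeast hne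
  have hRr : R < r := lt_of_lt_of_le hu0 hr1
  have hpos : ∀ s, R < s → s < r → 0 < g s := by
    intro s hs hsr
    by_contra hn
    rcases lt_or_ge s u with h | h
    · exact hn (hu' ⟨hs, h⟩)
    · exact absurd (hmin ⟨⟨h, hsr.le.trans hr2⟩, not_lt.1 hn⟩) (not_le.2 hsr)
  refine ⟨r, hRr, hr2, le_antisymm hr3 ?_, hpos⟩
  have hc : Filter.Tendsto g (nhdsWithin r (Set.Iio r)) (nhds (g r)) :=
    ((hg.continuousAt (Ici_mem_nhds hRr)).tendsto).mono_left nhdsWithin_le_nhds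
  refine ge_of_tendsto hc ?_
  filter_upwards [Ioo_mem_nhdsLT hRr] with x hx
  exact (hpos x hx.1 hx.2).le

set_option maxHeartbeats 2000000 in
/-- Theorem 1 of the paper. There are positive constants
`B₀, B₁, B₂, δ` depending only on `L₀, C₁, C₂, C₃, q` such that every reduced
static shell with inner radius `R₀ ≤ δ` satisfies: `γ > 0` on
`(R₀, R₀ + B₀·R₀^((q+3)/(q+1))]`, and there is an outer radius `R₁` with
`R₀ + B₀·R₀^((q+3)/(q+1)) ≤ R₁ ≤ (R₀ + B₂·R₀^((q+2)/(q+1)))/(1 - B₁·R₀^(2/(q+1)))`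
such that `γ > 0` on `(R₀, R₁)` and `γ(R₁) = 0`; in particular `ρ, p, z`
vanish at `R₁`. -/
theorem static_shell_support (L₀ C₁ C₂ C₃ q : ℝ)
    (hL₀ : 0 < L₀) (hC₁ : 0 < C₁) (hC₂ : 0 < C₂) (hC₃ : 0 < C₃) (hq : 2 ≤ q) :
    ∃ B₀ B₁ B₂ δ : ℝ, 0 < B₀ ∧ 0 < B₁ ∧ 0 < B₂ ∧ 0 < δ ∧
      ∀ (R₀ : ℝ) (μ : ℝ → ℝ), 0 < R₀ → R₀ ≤ δ →
        IsReducedShell R₀ L₀ C₁ C₂ q μ →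
        (∀ r, R₀ < r → r ≤ R₀ + B₀ * R₀ ^ ((q + 3) / (q + 1)) → 0 < gam L₀ μ r) ∧
        ∃ R₁ : ℝ,
          R₀ + B₀ * R₀ ^ ((q + 3) / (q + 1)) ≤ R₁ ∧
          R₁ ≤ (R₀ + B₂ * R₀ ^ ((q + 2) / (q + 1))) / (1 - B₁ * R₀ ^ (2 / (q + 1))) ∧
          (∀ r, R₀ < r → r < R₁ → 0 < gam L₀ μ r) ∧
          gam L₀ μ R₁ = 0 ∧
          rho L₀ C₁ q μ R₁ = 0 ∧ pres L₀ C₂ q μ R₁ = 0 ∧ zfun L₀ C₃ q μ R₁ = 0 := by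
  set A := 4 * π * C₂ with hA
  have hA0 : 0 < A := by positivity
  set κ := (q + 1) / (4 * π * C₁) with hκ
  have hq1 : 0 < q + 1 := by linarith
  have hκ0 : 0 < κ := by positivity
  set c := min κ (1 / (4 * A)) with hc
  have hc0 : 0 < c := lt_min hκ0 (by positivity)
  have hcκ : c ≤ κ := min_le_left _ _
  have hAc : 4 * A * c ≤ 1 := by
    have : c ≤ 1 / (4 * A) := min_le_right _ _
    rw [le_div_iff₀ (by positivity)] at this
    linarith
  obtain ⟨ε, hε⟩ : ∃ ε, ε = c / (108 * κ) := ⟨_, rfl⟩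
  have hε0 : 0 < ε := by rw [hε]; positivity
  have hεκ : ε * κ = c / 108 := by rw [hε]; field_simp
  have hε1 : ε ≤ 1 / 108 := by nlinarith
  set k := c * ε / 2 with hk
  have hk0 : 0 < k := by positivity
  set K := π * C₁ * k ^ (q / (q + 1)) / (q + 1) with hK
  have hK0 : 0 < K := by positivity
  obtain ⟨S₁, hS₁⟩ : ∃ S, S = 1 / K := ⟨_, rfl⟩
  have hS₁0 : 0 < S₁ := by rw [hS₁]; positivity
  obtain ⟨S₂, hS₂⟩ : ∃ S, S = S₁ * (1 + 4 / ε) := ⟨_, rfl⟩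
  have hS₂0 : 0 < S₂ := by rw [hS₂]; positivity
  obtain ⟨B₀, hB₀⟩ : ∃ B, B = min 1 (1 / (16 * π * C₁)) := ⟨_, rfl⟩
  have hB₀0 : 0 < B₀ := by rw [hB₀]; exact lt_min one_pos (by positivity)
  have hB₀1 : B₀ ≤ 1 := by rw [hB₀]; exact min_le_left _ _
  have hB₀2 : 16 * π * C₁ * B₀ ≤ 1 := by
    have : B₀ ≤ 1 / (16 * π * C₁) := by rw [hB₀]; exact min_le_right _ _
    rw [le_div_iff₀ (by positivity)] at this
    linarith
  refine ⟨B₀, S₂, 1, min ((ε / (2 * S₂)) ^ ((q + 1) / 2)) (Real.sqrt (ε * L₀ / 16)), hB₀0, hS₂0,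
    one_pos, lt_min (by positivity) (by positivity), ?_⟩
  intro R μ hR hRδ hs
  have hRε : 4 * R ^ 2 ≤ ε / 4 * L₀ := by
    have h1 := hRδ.trans (min_le_right _ _)
    have h2 := (Real.le_sqrt hR.le (by positivity)).1 h1
    linarith
  obtain ⟨t, ht⟩ : ∃ t, t = R ^ (2 / (q + 1)) := ⟨_, rfl⟩
  have ht0 : 0 < t := by rw [ht]; positivity
  have htS : S₂ * t ≤ ε / 2 := by
    have h1 := Real.rpow_le_rpow hR.le (hRδ.trans (min_le_left _ _))
      (by positivity : 0 ≤ 2 / (q + 1))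
    rw [← Real.rpow_mul (by positivity), ← ht] at h1
    have e : (q + 1) / 2 * (2 / (q + 1)) = 1 := by field_simp
    rw [e, Real.rpow_one, le_div_iff₀ (by positivity)] at h1
    linarith
  have htq : t ^ (q + 1) = R ^ 2 := by
    rw [ht, ← Real.rpow_mul hR.le, div_mul_cancel₀ _ hq1.ne', Real.rpow_two]
  have hRt : R ^ ((q + 3) / (q + 1)) = R * t := by
    have : (q + 3) / (q + 1) = 1 + 2 / (q + 1) := by field_simp; ring
    rw [this, Real.rpow_add hR, Real.rpow_one, ht]
  have hS12 : S₁ < S₂ := by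
    rw [hS₂]
    have : 0 < S₁ * (4 / ε) := by positivity
    linarith
  set r₃ := R + S₂ * (R * t) with hr₃
  set r₂ := R + S₁ * (R * t) with hr₂
  have hRt0 : 0 < R * t := by positivity
  have hRr₂ : R < r₂ := by rw [hr₂]; linarith [mul_pos hS₁0 hRt0]
  have hr₂₃ : r₂ < r₃ := by rw [hr₂, hr₃]; linarith [mul_lt_mul_of_pos_right hS12 hRt0]
  have hr₃b : r₃ ≤ (1 + ε / 2) * R := by
    have := mul_le_mul_of_nonneg_left htS hR.le
    rw [hr₃]; linarith
  have hr₃2 : r₃ ≤ 2 * R := by nlinarith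
  -- the shell does end before `r₃`
  have hex : ∃ s, R < s ∧ s ≤ r₃ ∧ gam L₀ μ s ≤ 0 := by
    by_contra hcon
    push Not at hcon
    have hN2 : 1 / 3 + ε / 2 ≤ mass R L₀ C₁ q μ r₂ / R := by
      by_contra hlt
      rw [not_le] at hlt
      have hgr := growth hL₀ hR hq hC₁ hs hk0 hRr₂ (hr₂₃.le.trans hr₃2)
        (fun s h1 h2 => hcon s h1 (h2.le.trans hr₂₃.le)) (by
          intro s h1 h2
          have hgs := hcon s h1 (h2.le.trans hr₂₃.le)
          have hms : mass R L₀ C₁ q μ s / R ≤ mass R L₀ C₁ q μ r₂ / R :=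
            div_le_div_of_nonneg_right (mass_mono hL₀ hR hq hC₁ hs r₂ hRr₂.le
              ⟨h1.le, h2.le⟩ (Set.right_mem_Icc.2 hRr₂.le) h2.le) hR.le
          have hm0 : 0 ≤ mass R L₀ C₁ q μ s / R :=
            div_nonneg (mass_nonneg hL₀ hR hq hC₁ hs h1.le) hR.le
          have hbar := barrier hL₀ hR hq hC₁ hC₂ hs hA hκ hc0 hcκ hAc hε hRε h1.le
            ((h2.le.trans hr₂₃.le).trans hr₃b)
            (fun u hu1 hu2 => hcon u hu1 ((hu2.trans h2).le.trans hr₂₃.le)) (by linarith)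
          rw [max_eq_left hgs.le] at hbar
          refine le_trans ?_ hbar
          have : ε / 2 ≤ 1 / 3 + ε - mass R L₀ C₁ q μ s / R := by linarith
          have := mul_le_mul_of_nonneg_left this (mul_nonneg hc0.le hm0)
          rw [hk]; linarith)
      rw [← hK, ← ht] at hgr
      have e : K * (r₂ - R) = R * t := by rw [hr₂, hS₁]; field_simp; ring
      rw [e] at hgr
      have hm0 : 0 ≤ mass R L₀ C₁ q μ r₂ / R :=
            div_nonneg (mass_nonneg hL₀ hR hq hC₁ hs hRr₂.le) hR.le
      have := Real.rpow_lt_one hm0 (by linarith) (by positivity : 0 < 1 / (q + 1))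
      have := mul_lt_mul_of_pos_right this hRt0
      linarith
    have hcont : ∀ x ∈ Set.Icc r₂ r₃, HasDerivAt (fun x => gam L₀ μ x + ε / (4 * R) * (x - r₂))
        (gamder R L₀ C₁ C₂ q μ x + ε / (4 * R) * 1) x := fun x hx =>
      (gam_hasDerivAt hL₀ hR hs (hRr₂.le.trans hx.1)).add
        (((hasDerivAt_id x).sub_const r₂).const_mul _)
    have hanti : AntitoneOn (fun x => gam L₀ μ x + ε / (4 * R) * (x - r₂)) (Set.Icc r₂ r₃) := by
      refine antitoneOn_of_hasDerivWithinAt_nonpos (convex_Icc _ _)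
        (fun x hx => (hcont x hx).continuousAt.continuousWithinAt)
        (fun x hx => (hcont x (interior_subset hx)).hasDerivWithinAt) ?_
      intro x hx
      obtain ⟨hx1, hx2⟩ := (interior_subset hx : x ∈ Set.Icc r₂ r₃)
      have hRx : R ≤ x := hRr₂.le.trans hx1
      have hx0 : 0 < x := by linarith
      have h1 := gamder_le hL₀ hR hq hC₁ hC₂ hs hRx
      have h2 := hs.mass_lt x hRx
      have e : 2 * mass R L₀ C₁ q μ x / x = 2 * (mass R L₀ C₁ q μ x / x) := by ring
      rw [e] at h2
      have hM : 1 / 3 + ε / 4 ≤ mass R L₀ C₁ q μ x / x := by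
        rw [le_div_iff₀ hx0]
        rw [le_div_iff₀ hR] at hN2
        have h3 := mass_mono hL₀ hR hq hC₁ hs x hRx ⟨hRr₂.le, hx1⟩ (Set.right_mem_Icc.2 hRx) hx1
        have h4 : (1 / 3 + ε / 4) * x ≤ (1 / 3 + ε / 4) * ((1 + ε / 2) * R) :=
          mul_le_mul_of_nonneg_left (hx2.trans hr₃b) (by positivity)
        have h5 : (1 / 3 + ε / 4) * (1 + ε / 2) ≤ 1 / 3 + ε / 2 := by nlinarith
        have h6 := mul_le_mul_of_nonneg_right h5 hR.le
        linarith
      have hM0 : 0 ≤ mass R L₀ C₁ q μ x / x := by linarith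
      have h3 : 1 + 3 * ε / 4 ≤ (mass R L₀ C₁ q μ x / x) / (1 - 2 * (mass R L₀ C₁ q μ x / x)) := by
        rw [le_div_iff₀ (by linarith)]
        nlinarith
      have h4 : x * gamder R L₀ C₁ C₂ q μ x ≤ - (ε / 2) := by linarith
      have h5 : x * (ε / (4 * R)) ≤ ε / 2 := by
        have : x * (ε / (4 * R)) = (ε / 4) * (x / R) := by field_simp
        have h6 : x / R ≤ 2 := by rw [div_le_iff₀ hR]; linarith
        rw [this]; nlinarith
      have h6 : x * (gamder R L₀ C₁ C₂ q μ x + ε / (4 * R)) ≤ 0 := by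
        rw [mul_add]; linarith
      have := nonpos_of_mul_nonpos_right h6 hx0
      linarith
    have h1 := hanti (Set.left_mem_Icc.2 hr₂₃.le) (Set.right_mem_Icc.2 hr₂₃.le) hr₂₃.le
    simp only [sub_self, mul_zero, add_zero] at h1
    have h2 := gam_le hL₀ hR hq hC₁ hC₂ hs hRr₂.le
    have e1 : (r₂ - R) / R = S₁ * t := by rw [hr₂]; field_simp; ring
    have e2 : ε / (4 * R) * (r₃ - r₂) = S₁ * t := by
      rw [hr₂, hr₃, hS₂]; field_simp; ring
    have h3 := hcon r₃ (hRr₂.trans hr₂₃) le_rfl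
    linarith
  have hd0 : 0 < gamder R L₀ C₁ C₂ q μ R := by
    have : R * gamder R L₀ C₁ C₂ q μ R = L₀ / (R ^ 2 + L₀) := by
      rw [gamder_eq hL₀ hR, hs.inner_zero, mass_self, max_self, Real.zero_rpow hq1.ne']
      simp
    have h1 : 0 < R * gamder R L₀ C₁ C₂ q μ R := by rw [this]; positivity
    exact (mul_pos_iff_of_pos_left hR).1 h1
  obtain ⟨R₁, hR₁, hR₁3, hz, hpos⟩ := first_zero (gam_cont hL₀ hR hs) hs.inner_zero
    (gam_hasDerivAt hL₀ hR hs le_rfl) hd0 hex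
  have hlow : R + B₀ * (R * t) < R₁ := by
    by_contra hle
    rw [not_lt] at hle
    have hmle := mass_le hL₀ hR hq hC₁ hs (G := B₀ * t) hR₁.le (by positivity) (by
      intro s h1 h2
      refine (gam_le hL₀ hR hq hC₁ hC₂ hs h1.le).trans ?_
      rw [div_le_iff₀ hR]
      linarith)
    have hbnd : mass R L₀ C₁ q μ R₁ / R ≤ 1 / 4 := by
      rw [div_le_iff₀ hR]
      refine hmle.trans ?_
      have h1 : 4 * π * C₁ * (B₀ * t) ^ q / R ^ 2 * (R₁ - R) ≤
          4 * π * C₁ * (B₀ * t) ^ q / R ^ 2 * (B₀ * t * R) :=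
        mul_le_mul_of_nonneg_left (by linarith) (by positivity)
      refine h1.trans ?_
      have e : 4 * π * C₁ * (B₀ * t) ^ q / R ^ 2 * (B₀ * t * R) =
          4 * π * C₁ * B₀ ^ (q + 1) * R := by
        have e1 : (B₀ * t) ^ q * (B₀ * t) = B₀ ^ (q + 1) * R ^ 2 := by
          rw [← htq, ← Real.mul_rpow hB₀0.le ht0.le, Real.rpow_add_one (by positivity)]
        calc _ = 4 * π * C₁ * ((B₀ * t) ^ q * (B₀ * t)) / R ^ 2 * R := by ring
          _ = _ := by rw [e1]; field_simp
      rw [e]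
      have h2 : B₀ ^ (q + 1) ≤ B₀ := by
        have := Real.rpow_le_rpow_of_exponent_ge hB₀0 hB₀1 (by linarith : (1 : ℝ) ≤ q + 1)
        rwa [Real.rpow_one] at this
      refine mul_le_mul_of_nonneg_right ?_ hR.le
      have := mul_le_mul_of_nonneg_left h2 (by positivity : 0 ≤ 4 * π * C₁)
      linarith
    have hbar := barrier hL₀ hR hq hC₁ hC₂ hs hA hκ hc0 hcκ hAc hε hRε hR₁.le
      (hR₁3.trans hr₃b) hpos (by linarith)
    rw [hz, max_self, Real.zero_rpow hq1.ne', zero_div] at hbar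
    have hmp : 0 < mass R L₀ C₁ q μ R₁ / R := div_pos (mass_pos hL₀ hR hq hC₁ hs hR₁ hpos) hR
    have : 0 < c * (mass R L₀ C₁ q μ R₁ / R) * (1 / 3 + ε - mass R L₀ C₁ q μ R₁ / R) :=
      mul_pos (mul_pos hc0 hmp) (by linarith)
    linarith
  rw [hRt, ← ht]
  refine ⟨fun r h1 h2 => hpos r h1 (lt_of_le_of_lt h2 hlow), R₁, hlow.le, ?_, hpos, hz, ?_, ?_, ?_⟩
  · refine hR₁3.trans ?_
    rw [le_div_iff₀ (by linarith), hr₃]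
    have : 0 < R ^ ((q + 2) / (q + 1)) := by positivity
    have h2 : 0 ≤ R * (S₂ * t) ^ 2 := by positivity
    nlinarith
  · unfold rho; rw [hz, max_self, Real.zero_rpow (by linarith)]; simp
  · unfold pres; rw [hz, max_self, Real.zero_rpow (by linarith)]; simp
  · unfold zfun; rw [hz, max_self, Real.zero_rpow (by linarith)]; simp

end
end

section
/- Let 0 < a < b, let m : [a, b] → ℝ be differentiable with m(a) = 0 and 2m(r)/r < 1 for all r ∈ [a, b], let ρ : [a, b] → ℝ be continuous with ρ ≥ 0 and m'(r) = 4π r² ρ(r), and define λ(r) = −(1/2)·log(1 − 2m(r)/r). Then: (i) ∫_a^b 4π η ρ(η) e^{λ(η)} dη ≥ 1 − √(1 − 2m(b)/b) = 2m(b)/(b(1 + √(1 − 2m(b)/b))); and (ii) if additionally λ(r) ≤ C_λ for all r ∈ [a, b] for some constant C_λ, then ∫_a^b 4π η ρ(η) e^{λ(η)} dη ≤ 1 − √(1 − 2m(b)/b) + e^{C_λ} · m(b) · (b − a)/(ab). -/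
open Real MeasureTheory

/-- two-sided bounds from the proof of Proposition 1 of
the paper. With `m(a) = 0`, `m' = 4πr²ρ ≥ 0`, `2m/r < 1` and
`λ = -(1/2)·log(1 - 2m/r)`:
(i) `∫_a^b 4πηρe^λ dη ≥ 1 - √(1 - 2m(b)/b) = 2m(b)/(b(1 + √(1 - 2m(b)/b)))`;
(ii) if `λ ≤ C_λ` on `[a,b]`, then
`∫_a^b 4πηρe^λ dη ≤ 1 - √(1 - 2m(b)/b) + e^{C_λ}·m(b)·(b-a)/(ab)`. -/
theorem integral_rho_lambda_bounds (a b : ℝ) (m ρ : ℝ → ℝ)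
    (ha : 0 < a) (hab : a < b)
    (hma : m a = 0)
    (hbound : ∀ r ∈ Set.Icc a b, 2 * m r / r < 1)
    (hρcont : ContinuousOn ρ (Set.Icc a b))
    (hρnonneg : ∀ r ∈ Set.Icc a b, 0 ≤ ρ r)
    (hm : ∀ r ∈ Set.Icc a b, HasDerivAt m (4 * π * r ^ 2 * ρ r) r) :
    (1 - Real.sqrt (1 - 2 * m b / b) ≤
      ∫ η in a..b,
        4 * π * η * ρ η * Real.exp (-(1 / 2) * Real.log (1 - 2 * m η / η))) ∧
    (1 - Real.sqrt (1 - 2 * m b / b) =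
      2 * m b / (b * (1 + Real.sqrt (1 - 2 * m b / b)))) ∧
    ∀ Clam : ℝ, (∀ r ∈ Set.Icc a b, -(1 / 2) * Real.log (1 - 2 * m r / r) ≤ Clam) →
      (∫ η in a..b,
          4 * π * η * ρ η * Real.exp (-(1 / 2) * Real.log (1 - 2 * m η / η))) ≤
        1 - Real.sqrt (1 - 2 * m b / b) + Real.exp Clam * m b * (b - a) / (a * b) := by
  have hpos : ∀ r ∈ Set.Icc a b, 0 < r := fun r hr => lt_of_lt_of_le ha hr.1
  have hx : ∀ r ∈ Set.Icc a b, 0 < 1 - 2 * m r / r := fun r hr => by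
    linarith [hbound r hr]
  have hamem : a ∈ Set.Icc a b := ⟨le_refl a, hab.le⟩
  have hbmem : b ∈ Set.Icc a b := ⟨hab.le, le_refl b⟩
  have hmcont : ContinuousOn m (Set.Icc a b) := fun r hr =>
    (hm r hr).continuousAt.continuousWithinAt
  have hmono : MonotoneOn m (Set.Icc a b) := by
    apply monotoneOn_of_deriv_nonneg (convex_Icc a b) hmcont
    · intro r hr
      exact (hm r (interior_subset hr)).differentiableAt.differentiableWithinAt
    · intro r hr
      have hr' := interior_subset hr
      rw [(hm r hr').deriv]
      have := hρnonneg r hr'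
      positivity
  have hm0 : ∀ r ∈ Set.Icc a b, 0 ≤ m r := fun r hr => by
    rw [← hma]; exact hmono hamem hr hr.1
  have hexp : ∀ x : ℝ, 0 < x → Real.exp (-(1 / 2) * Real.log x) = 1 / Real.sqrt x := by
    intro x hx0
    rw [Real.sqrt_eq_rpow, Real.rpow_def_of_pos hx0, one_div (Real.exp _), ← Real.exp_neg]
    congr 1; ring
  set E : ℝ → ℝ := fun η => Real.exp (-(1 / 2) * Real.log (1 - 2 * m η / η)) with hE
  have hEcont : ContinuousOn E (Set.Icc a b) := by
    apply Real.continuous_exp.comp_continuousOn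
    apply continuousOn_const.mul
    apply ContinuousOn.log
    · exact continuousOn_const.sub ((continuousOn_const.mul hmcont).div continuousOn_id
        (fun r hr => (hpos r hr).ne'))
    · exact fun r hr => (hx r hr).ne'
  have hui : Set.uIcc a b = Set.Icc a b := Set.uIcc_of_le hab.le
  have hgi : IntervalIntegrable (fun η => 4 * π * η * ρ η * E η) volume a b := by
    apply ContinuousOn.intervalIntegrable
    rw [hui]
    exact ((continuousOn_const.mul continuousOn_id).mul hρcont).mul hEcont
  have hhi : IntervalIntegrable (fun η => m η / η ^ 2 * E η) volume a b := by
    apply ContinuousOn.intervalIntegrable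
    rw [hui]
    exact (hmcont.div (continuousOn_id.pow 2)
      (fun r hr => (pow_pos (hpos r hr) 2).ne')).mul hEcont
  have hF : ∀ r ∈ Set.uIcc a b, HasDerivAt (fun r => 1 - Real.sqrt (1 - 2 * m r / r))
      (4 * π * r * ρ r * E r - m r / r ^ 2 * E r) r := by
    intro r hr
    rw [hui] at hr
    have hr0 := (hpos r hr).ne'
    have h1 := (((((hm r hr).const_mul 2).div (hasDerivAt_id r) hr0).const_sub 1).sqrt
      (hx r hr).ne').const_sub 1
    have hs : Real.sqrt (1 - 2 * m r / r) ≠ 0 := (Real.sqrt_pos.2 (hx r hr)).ne'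
    refine h1.congr_deriv ?_
    simp only [hE, hexp _ (hx r hr), id, Pi.div_apply]
    field_simp
  have hFTC := intervalIntegral.integral_eq_sub_of_hasDerivAt hF (hgi.sub hhi)
  rw [intervalIntegral.integral_sub hgi hhi] at hFTC
  simp only [hma, mul_zero, zero_div, sub_zero, Real.sqrt_one, sub_self] at hFTC
  refine ⟨?_, ?_, ?_⟩
  · have : 0 ≤ ∫ η in a..b, m η / η ^ 2 * E η := by
      apply intervalIntegral.integral_nonneg hab.le
      intro r hr
      exact mul_nonneg (div_nonneg (hm0 r hr) (sq_nonneg r)) (Real.exp_pos _).le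
    linarith
  · have hb := hpos b hbmem
    have h2 := Real.sq_sqrt (hx b hbmem).le
    have h3 := Real.sqrt_nonneg (1 - 2 * m b / b)
    set s := Real.sqrt (1 - 2 * m b / b)
    rw [eq_div_iff (by positivity)]
    have h4 : 2 * m b = b * (1 - s ^ 2) := by
      rw [h2]; field_simp; ring
    rw [h4]; ring
  · intro C hC
    have hd : ∀ r ∈ Set.uIcc a b, HasDerivAt (fun r => -(Real.exp C * m b) * r⁻¹)
        (Real.exp C * m b / r ^ 2) r := by
      intro r hr
      rw [hui] at hr
      refine ((hasDerivAt_inv (hpos r hr).ne').const_mul _).congr_deriv ?_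
      ring
    have hki : IntervalIntegrable (fun r => Real.exp C * m b / r ^ 2) volume a b := by
      apply ContinuousOn.intervalIntegrable
      rw [hui]
      exact continuousOn_const.div (continuousOn_id.pow 2)
        (fun r hr => (pow_pos (hpos r hr) 2).ne')
    have h5 := intervalIntegral.integral_eq_sub_of_hasDerivAt hd hki
    have h6 : ∫ η in a..b, m η / η ^ 2 * E η ≤ ∫ η in a..b, Real.exp C * m b / η ^ 2 := by
      apply intervalIntegral.integral_mono_on hab.le hhi hki
      intro r hr
      have e1 : E r ≤ Real.exp C := Real.exp_le_exp.2 (hC r hr)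
      have e2 : m r ≤ m b := hmono hr hbmem hr.2
      have e3 : m r * E r ≤ m b * Real.exp C :=
        mul_le_mul e2 e1 (Real.exp_pos _).le (hm0 b hbmem)
      rw [div_mul_eq_mul_div]
      apply div_le_div_of_nonneg_right _ (sq_nonneg r)
      linarith
    have h7 : Real.exp C * m b * (b - a) / (a * b) =
        -(Real.exp C * m b) * b⁻¹ - -(Real.exp C * m b) * a⁻¹ := by
      have := (hpos b hbmem).ne'
      field_simp
      ring
    rw [h7]
    linarith
end

section
/- Let 0 < r₂ ≤ R and let x : [r₂, R] → ℝ be differentiable with x(r₂) > 3/4 and r·x'(r) ≥ (4/3)·x(r)² − x(r) for all r ∈ [r₂, R]. Then R < r₂ · x(r₂)/(x(r₂) − 3/4). -/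
open Real

/-- Riccati-type blow-up comparison, in the style of
Makino, used at the end of the proof of Theorem 1 of the paper. A
differentiable `x : [r₂, R] → ℝ` with `x(r₂) > 3/4` and
`r·x'(r) ≥ (4/3)x(r)² - x(r)` cannot exist up to radius
`r₂·x(r₂)/(x(r₂) - 3/4)`. -/
theorem riccati_blowup (r₂ R : ℝ) (x x' : ℝ → ℝ)
    (hr₂ : 0 < r₂) (hle : r₂ ≤ R)
    (hderiv : ∀ r ∈ Set.Icc r₂ R, HasDerivAt x (x' r) r)
    (hstart : 3 / 4 < x r₂)
    (hineq : ∀ r ∈ Set.Icc r₂ R, (4 / 3) * x r ^ 2 - x r ≤ r * x' r) :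
    R < r₂ * x r₂ / (x r₂ - 3 / 4) := by
  have hpos : ∀ r ∈ Set.Icc r₂ R, x r₂ ≤ x r := by
    intro r hr
    have h := image_le_of_deriv_right_lt_deriv_boundary (f := fun r => - x r)
      (f' := fun r => - x' r) (a := r₂) (b := R) (B := fun _ => - x r₂) (B' := fun _ => 0)
      (fun r hr => (hderiv r hr).neg.continuousAt.continuousWithinAt)
      (fun r hr => (hderiv r ⟨hr.1, hr.2.le⟩).neg.hasDerivWithinAt)
      le_rfl (fun r => hasDerivAt_const r _)
      (by
        intro r hr he
        have h1 := hineq r ⟨hr.1, hr.2.le⟩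
        have he' : x r = x r₂ := by simpa using he
        rw [he'] at h1
        have h2 : 0 < r * x' r := by nlinarith
        have h3 : 0 < x' r := pos_of_mul_pos_right h2 (by linarith [hr.1])
        simpa using h3) hr
    simpa using h
  have hmono : MonotoneOn (fun r => (1 - (3 / 4) * (x r)⁻¹) * r⁻¹) (Set.Icc r₂ R) := by
    have hd : ∀ r ∈ Set.Icc r₂ R, HasDerivAt (fun r => (1 - (3 / 4) * (x r)⁻¹) * r⁻¹)
        (((3 / 4) * (r * x' r) - x r ^ 2 + (3 / 4) * x r) / (x r ^ 2 * r ^ 2)) r := by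
      intro r hr
      have hx : x r ≠ 0 := by
        have := hpos r hr
        exact (by linarith : 0 < x r).ne'
      have hr0 : r ≠ 0 := (lt_of_lt_of_le hr₂ hr.1).ne'
      have h := ((((hderiv r hr).fun_inv hx).const_mul (3 / 4)).const_sub 1).fun_mul
        (hasDerivAt_inv hr0)
      refine h.congr_deriv ?_
      field_simp
      ring
    refine monotoneOn_of_hasDerivWithinAt_nonneg (convex_Icc _ _)
      (fun r hr => (hd r hr).continuousAt.continuousWithinAt)
      (fun r hr => (hd r (interior_subset hr)).hasDerivWithinAt) ?_
    intro r hr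
    have := hineq r (interior_subset hr)
    apply div_nonneg
    · linarith
    · positivity
  have h := hmono (Set.left_mem_Icc.2 hle) (Set.right_mem_Icc.2 hle) hle
  have hR : 0 < R := by linarith
  have hxR : 0 < x R := by linarith [hpos R (Set.right_mem_Icc.2 hle)]
  have hx2 : 0 < x r₂ := by linarith
  have hlt : (1 - (3 / 4) * (x r₂)⁻¹) * r₂⁻¹ < R⁻¹ := by
    refine lt_of_le_of_lt h ?_
    have : 0 < (x R)⁻¹ := by positivity
    have : 0 < R⁻¹ := by positivity
    nlinarith [mul_pos ‹0 < (x R)⁻¹› ‹0 < R⁻¹›]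
  have e : (1 - (3 / 4) * (x r₂)⁻¹) * r₂⁻¹ = (x r₂ - 3 / 4) / (r₂ * x r₂) := by
    field_simp
  rw [e, inv_eq_one_div, div_lt_div_iff₀ (by positivity) hR] at hlt
  rw [lt_div_iff₀ (by linarith)]
  linarith
end
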